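/- Let G ≤ AGL(d,p) be a primitive solvable permutation group on V = GF(p)^d with zero-stabilizer H ≤ GL(d,p) irreducible. If there exists a nonzero vector α ∈ V such that the permutation group induced by H on the orbit Δ = α^H is 2-closed, then G is 3-closed. -/

import Mathlib

/-- Two subgroups of `Perm Ω` have the same orbits on `Ω^m` under the
componentwise action (`m`-equivalence). -/
def SameOrbits {Ω : Type*} (m : ℕ) (G H : Subgroup (Equiv.Perm Ω)) : Prop :=
  ∀ α β : Fin m → Ω,
    (∃ g ∈ G, ∀ i, g (α i) = β i) ↔ (∃ h ∈ H, ∀ i, h (α i) = β i)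

/-- The `m`-closure of `G`: the largest subgroup of `Perm Ω` having the same
orbits as `G` on `Ω^m`. -/
def mClosure {Ω : Type*} (m : ℕ) (G : Subgroup (Equiv.Perm Ω)) :
    Subgroup (Equiv.Perm Ω) :=
  sSup {H | SameOrbits m G H}

/-- A subgroup of `Perm Ω` is primitive: it is transitive and every block
(a set that each group element maps to itself or to a disjoint set)
is trivial. -/
def IsPrimitiveSubgroup {Ω : Type*} (G : Subgroup (Equiv.Perm Ω)) : Prop :=
  (∀ x y : Ω, ∃ g ∈ G, g x = y) ∧
    ∀ B : Set Ω, (∀ g ∈ G, g '' B = B ∨ Disjoint (g '' B) B) →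
      B.Subsingleton ∨ B = Set.univ

structure Ctx {R V Q : Type} [CommRing R] [AddCommGroup V] [Module R V] [CommGroup Q]
    (ι : Q →* R) (L : Set (V ≃+ V)) (r : ℕ) : Prop where
  hspan : AddSubgroup.closure (Set.range ι) = ⊤
  hr : r.Prime
  hexp : ∀ q : Q, q ^ r = 1
  hfix : ∀ v : V, (∀ q, ι q • v = v) → v = 0
  h2 : ∀ v : V, v + v = 0
  hodd : Odd (Nat.card Q)
  hsymm : ∀ h ∈ L, h.symm ∈ L
  hnorm : ∀ h ∈ L, ∀ q, ∃ qq, ∀ v, h (ι q • v) = ι qq • h v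

/-- `x` looks like an affine map with linear part in `L` on each triple. -/
def TriP {V : Type} [AddCommGroup V] (L : Set (V ≃+ V)) (x : Equiv.Perm V) : Prop :=
  ∀ a b c, ∃ h ∈ L, x b - x a = h (b - a) ∧ x c - x a = h (c - a)

set_option linter.unusedSectionVars false

section core
variable {R V Q : Type} [CommRing R] [AddCommGroup V] [Module R V] [CommGroup Q]
    [Finite Q] [Finite V] {ι : Q →* R} {L : Set (V ≃+ V)} {r : ℕ}

theorem Ctx.gen (C : Ctx ι L r) (S : AddSubgroup V) (hS : ∀ q, ∀ s ∈ S, ι q • s ∈ S)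
    (ρ : R) (s : V) (hs : s ∈ S) : ρ • s ∈ S := by
  have hρ : ρ ∈ AddSubgroup.closure (Set.range ι) := by rw [C.hspan]; trivial
  induction hρ using AddSubgroup.closure_induction with
  | mem x hx => obtain ⟨q, rfl⟩ := hx; exact hS q s hs
  | zero => simp
  | add x y _ _ hx hy => rw [add_smul]; exact S.add_mem hx hy
  | neg x _ hx => rw [neg_smul]; exact S.neg_mem hx

theorem Ctx.closed (C : Ctx ι L r) (S : Set V) (h0 : 0 ∈ S)
    (hS : ∀ a ∈ S, ∀ b ∈ S, ∀ q, a + ι q • (b - a) ∈ S) :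
    ∃ U : Submodule R V, (U : Set V) = S := by
  have hq : ∀ q, ∀ b ∈ S, ι q • b ∈ S := fun q b hb => by simpa using hS 0 h0 b hb q
  have hinv : ∀ q, ∀ v : V, ι q • ι q⁻¹ • v = v := fun q v => by
    rw [smul_smul, ← map_mul]; simp
  have h1 : ∀ a ∈ S, ∀ b ∈ S, ∀ q, b + (a - ι q • a) ∈ S := fun a ha b hb q => by
    have := hS a ha _ (hq q⁻¹ b hb) q
    rw [smul_sub, hinv] at this
    convert this using 1; abel
  have hneg : ∀ v : V, -v = v := fun v => neg_eq_of_add_eq_zero_left (C.h2 v)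
  have := Fintype.ofFinite Q
  have hsum : ∀ b : V, ∑ q : Q, (b - ι q • b) = b := by
    intro b
    have hz : ∑ q : Q, ι q • b = 0 := by
      apply C.hfix
      intro q
      rw [Finset.smul_sum]
      simp_rw [smul_smul, ← map_mul]
      exact Fintype.sum_equiv (Equiv.mulLeft q) _ _ (fun _ => rfl)
    rw [Finset.sum_sub_distrib, hz]
    obtain ⟨k, hk⟩ := C.hodd
    rw [Nat.card_eq_fintype_card] at hk
    simp only [Finset.sum_const, Finset.card_univ, hk]
    rw [add_smul, mul_comm, mul_smul, two_smul, C.h2]; simp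
  have hadd : ∀ a ∈ S, ∀ b ∈ S, b + a ∈ S := by
    intro a ha b hb
    have : ∀ s : Finset Q, b + ∑ q ∈ s, (a - ι q • a) ∈ S := by
      intro s
      induction s using Finset.cons_induction with
      | empty => simpa using hb
      | cons q s hqs ih =>
        rw [Finset.sum_cons, add_comm (a - _), ← add_assoc]
        exact h1 a ha _ ih q
    have h := this Finset.univ
    rwa [hsum] at h
  let A : AddSubgroup V :=
    { carrier := S, zero_mem' := h0, add_mem' := fun {a b} ha hb => hadd b hb a ha
      neg_mem' := fun {a} ha => by rwa [hneg] }
  exact ⟨{ A with smul_mem' := fun ρ s hs => C.gen A (fun q s hs => hq q s hs) ρ s hs }, rfl⟩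

theorem TriP.symm (C : Ctx ι L r) {x : Equiv.Perm V} (hx : TriP L x) : TriP L x.symm := by
  intro a b c
  obtain ⟨h, hh, h1, h2⟩ := hx (x.symm a) (x.symm b) (x.symm c)
  refine ⟨h.symm, C.hsymm h hh, ?_, ?_⟩
  · rw [AddEquiv.eq_symm_apply, ← h1]; simp
  · rw [AddEquiv.eq_symm_apply, ← h2]; simp

theorem Ctx.img_exists (C : Ctx ι L r) {x : Equiv.Perm V} (hx : TriP L x) (h0 : x 0 = 0)
    (U : Submodule R V) : ∃ U' : Submodule R V, (U' : Set V) = x '' U := by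
  apply C.closed
  · exact ⟨0, U.zero_mem, h0⟩
  · rintro _ ⟨a, ha, rfl⟩ _ ⟨b, hb, rfl⟩ q
    obtain ⟨d, hd⟩ := x.surjective (x a + ι q • (x b - x a))
    obtain ⟨h, hh, h1, h2⟩ := hx a b d
    obtain ⟨q', hq'⟩ := C.hnorm _ (C.hsymm h hh) q
    refine ⟨d, ?_, hd⟩
    rw [hd, h1] at h2
    have : d - a = ι q' • (b - a) := by
      have h3 := congrArg h.symm h2
      rw [add_sub_cancel_left, hq'] at h3
      simpa using h3.symm
    rw [sub_eq_iff_eq_add.mp this]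
    exact U.add_mem (U.smul_mem _ (U.sub_mem hb ha)) ha

noncomputable def Ctx.phi (C : Ctx ι L r) (x : Equiv.Perm V) (hx : TriP L x) (h0 : x 0 = 0) :
    Submodule R V ≃o Submodule R V where
  toFun U := (C.img_exists hx h0 U).choose
  invFun U := (C.img_exists (TriP.symm C hx) (by rw [Equiv.symm_apply_eq, h0]) U).choose
  left_inv U := by
    apply SetLike.coe_injective
    rw [(C.img_exists (TriP.symm C hx) (by rw [Equiv.symm_apply_eq, h0]) _).choose_spec, (C.img_exists hx h0 U).choose_spec]
    simp
  right_inv U := by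
    apply SetLike.coe_injective
    rw [(C.img_exists hx h0 _).choose_spec,
      (C.img_exists (TriP.symm C hx) (by rw [Equiv.symm_apply_eq, h0]) _).choose_spec]
    simp
  map_rel_iff' {U W} := by
    show (C.img_exists hx h0 U).choose ≤ (C.img_exists hx h0 W).choose ↔ _
    rw [← SetLike.coe_subset_coe, (C.img_exists hx h0 _).choose_spec,
      (C.img_exists hx h0 _).choose_spec, Set.image_subset_image_iff x.injective]
    rfl

theorem Ctx.coe_phi (C : Ctx ι L r) {x : Equiv.Perm V} (hx : TriP L x) (h0 : x 0 = 0)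
    (U : Submodule R V) : (C.phi x hx h0 U : Set V) = x '' U :=
  (C.img_exists hx h0 U).choose_spec

theorem Ctx.mem_phi (C : Ctx ι L r) {x : Equiv.Perm V} (hx : TriP L x) (h0 : x 0 = 0)
    (U : Submodule R V) (v : V) : v ∈ C.phi x hx h0 U ↔ ∃ u ∈ U, x u = v := by
  rw [← SetLike.mem_coe, C.coe_phi]; rfl

/-- Translate of `x`. -/
def trl (x : Equiv.Perm V) (w : V) : Equiv.Perm V :=
  (Equiv.addLeft w).trans (x.trans (Equiv.addRight (-(x w))))

theorem trl_apply (x : Equiv.Perm V) (w v : V) : trl x w v = x (w + v) - x w := by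
  simp [trl, sub_eq_add_neg]

theorem trl_zero (x : Equiv.Perm V) (w : V) : trl x w 0 = 0 := by simp [trl_apply]

theorem TriP.trl {x : Equiv.Perm V} (hx : TriP L x) (w : V) : TriP L (trl x w) := by
  intro a b c
  obtain ⟨h, hh, h1, h2⟩ := hx (w + a) (w + b) (w + c)
  refine ⟨h, hh, ?_, ?_⟩ <;> simp only [trl_apply, sub_sub_sub_cancel_right]
  · rw [h1]; simp
  · rw [h2]; simp

theorem Ctx.pair_aux (C : Ctx ι L r) {x : Equiv.Perm V} (hx : TriP L x) (h0 : x 0 = 0)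
    {A B : Submodule R V} (hA : IsAtom A) (hB : IsAtom B) (hne : A ≠ B) {u v : V}
    (hu : u ∈ A) (hv : v ∈ B) : x (u + v) - x u ∈ C.phi x hx h0 B := by
  by_cases hu0 : u = 0
  · subst hu0; simp [h0, C.mem_phi, hv]
  let φ := C.phi x hx h0
  let ψ := C.phi (trl x u) (hx.trl u) (trl_zero x u)
  have hdis : Disjoint A B := hA.disjoint_of_ne hB hne
  have hφA : IsAtom (φ A) := (OrderIso.isAtom_iff φ A).2 hA
  have hφB : IsAtom (φ B) := (OrderIso.isAtom_iff φ B).2 hB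
  have hψB : IsAtom (ψ B) := (OrderIso.isAtom_iff ψ B).2 hB
  have hmem : x (u + v) - x u ∈ ψ B := (C.mem_phi _ _ _ _).2 ⟨v, hv, trl_apply x u v⟩
  suffices h : ψ B = φ B by rwa [← h]
  by_contra hcon
  have hle : ψ B ≤ φ A ⊔ φ B := by
    rw [← OrderIso.map_sup]
    intro y hy
    obtain ⟨b, hb, rfl⟩ := (C.mem_phi _ _ _ _).1 hy
    rw [trl_apply]
    apply Submodule.sub_mem
    · exact (C.mem_phi _ _ _ _).2 ⟨u + b, Submodule.add_mem_sup hu hb, rfl⟩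
    · exact (C.mem_phi _ _ _ _).2 ⟨u, Submodule.mem_sup_left hu, rfl⟩
  have hd' : φ A ⊓ φ B = ⊥ := by
    rw [← OrderIso.map_inf, hdis.eq_bot, OrderIso.map_bot]
  have hcov : φ B ⋖ φ A ⊔ φ B := covBy_sup_of_inf_covBy_left (by rw [hd']; exact hφA.bot_covBy)
  have hlt : φ B < ψ B ⊔ φ B := by
    refine lt_of_le_of_ne le_sup_right fun h => hcon ?_
    have : ψ B ≤ φ B := by rw [h]; exact le_sup_left
    exact (hφB.le_iff_eq hψB.1).1 this
  have heq : ψ B ⊔ φ B = φ A ⊔ φ B :=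
    (hcov.eq_or_eq hlt.le (sup_le hle le_sup_right)).resolve_left hlt.ne'
  have hxu : x u ∈ ψ B ⊔ φ B := by
    rw [heq]; exact Submodule.mem_sup_left ((C.mem_phi _ _ _ _).2 ⟨u, hu, rfl⟩)
  obtain ⟨a, ha, b, hb, hab⟩ := Submodule.mem_sup.1 hxu
  obtain ⟨v1, hv1, h1⟩ := (C.mem_phi _ _ _ _).1 ((ψ B).neg_mem ha)
  obtain ⟨v2, hv2, h2⟩ := (C.mem_phi _ _ _ _).1 hb
  rw [trl_apply] at h1
  have : x (u + v1) = x v2 := by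
    rw [h2, sub_eq_iff_eq_add.1 h1, ← hab]; abel
  have h3 := x.injective this
  have : u ∈ B := by rw [eq_sub_of_add_eq h3]; exact B.sub_mem hv2 hv1
  exact hu0 ((Submodule.disjoint_def.1 hdis) u hu this)

theorem Ctx.pair (C : Ctx ι L r) {x : Equiv.Perm V} (hx : TriP L x) (h0 : x 0 = 0)
    {A B : Submodule R V} (hA : IsAtom A) (hB : IsAtom B) (hne : A ≠ B) {u v : V}
    (hu : u ∈ A) (hv : v ∈ B) : x (u + v) = x u + x v := by
  have h1 := C.pair_aux hx h0 hA hB hne hu hv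
  have h2 := C.pair_aux hx h0 hB hA hne.symm hv hu
  have hd' : Disjoint (C.phi x hx h0 A) (C.phi x hx h0 B) := by
    rw [disjoint_iff, ← OrderIso.map_inf, (hA.disjoint_of_ne hB hne).eq_bot, OrderIso.map_bot]
  have h3 : x (u + v) - x u - x v ∈ C.phi x hx h0 B :=
    Submodule.sub_mem _ h1 ((C.mem_phi _ _ _ _).2 ⟨v, hv, rfl⟩)
  have h4 : x (u + v) - x u - x v ∈ C.phi x hx h0 A := by
    rw [sub_right_comm, add_comm]
    exact Submodule.sub_mem _ h2 ((C.mem_phi _ _ _ _).2 ⟨u, hu, rfl⟩)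
  have := (Submodule.disjoint_def.1 hd') _ h4 h3
  rw [sub_sub, sub_eq_zero] at this
  exact this

theorem Ctx.addSub [IsSemisimpleModule R V] (C : Ctx ι L r) {U W : Submodule R V} (hU : IsAtom U)
    (hd : Disjoint U W) {u w : V} (hu : u ∈ U) (hw : w ∈ W) {x : Equiv.Perm V}
    (hx : TriP L x) (h0 : x 0 = 0) : x (w + u) = x w + x u := by
  have hW : W = ⨆ A : {A : Submodule R V // IsAtom A ∧ A ≤ W}, A.1 := by
    conv_lhs => rw [← sSup_atoms_le_eq W]
    rw [sSup_eq_iSup']; rfl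
  rw [hW] at hw
  suffices h : ∀ y : Equiv.Perm V, TriP L y → y 0 = 0 → y (w + u) = y w + y u from h x hx h0
  induction hw using Submodule.iSup_induction' with
  | mem A w hw =>
    intro y hy hy0
    refine C.pair hy hy0 A.2.1 hU ?_ hw hu
    intro h
    have : U ≤ W := h ▸ A.2.2
    exact hU.1 (hd.eq_bot_of_le this)
  | zero => intro y _ hy0; simp [hy0]
  | add w1 w2 _ _ ih1 ih2 =>
    intro y hy hy0
    have := ih2 (trl y w1) (hy.trl w1) (trl_zero y w1)
    simp only [trl_apply] at this
    rw [ih1 y hy hy0, sub_eq_iff_eq_add, ← add_assoc] at this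
    rw [this]; abel


theorem atom_scale {U : Submodule R V} (hU : IsAtom U) {u c : V} (hu : u ∈ U) (hu0 : u ≠ 0)
    (hc : c ∈ U) : ∃ ρ : R, ρ • u = c := by
  have hle : R ∙ u ≤ U := by simpa using hu
  have : R ∙ u = U := (hU.le_iff_eq (by simpa using hu0)).1 hle
  rw [← this] at hc
  exact Submodule.mem_span_singleton.1 hc

theorem atom_trans {U : Submodule R V} (hU : IsAtom U) {u c : V} (hu : u ∈ U) (hu0 : u ≠ 0)
    (hc : c ∈ U) {ρ σ : R} (h : ρ • u = σ • u) : ρ • c = σ • c := by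
  obtain ⟨τ, rfl⟩ := atom_scale hU hu hu0 hc
  rw [smul_comm, h, smul_comm]

theorem atom_max {U : Submodule R V} (hU : IsAtom U) {u : V} (hu : u ∈ U) (hu0 : u ≠ 0) :
    Ideal.IsMaximal (LinearMap.ker (LinearMap.toSpanSingleton R V u)) := by
  have : IsSimpleModule R U := isSimpleModule_iff_isAtom.2 hU
  have h := IsSimpleModule.ker_toSpanSingleton_isMaximal R (m := (⟨u, hu⟩ : U))
    (by simpa [Subtype.ext_iff] using hu0)
  have e : LinearMap.ker (LinearMap.toSpanSingleton R V u) =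
      LinearMap.ker (LinearMap.toSpanSingleton R U ⟨u, hu⟩) := by
    ext ρ
    simp [LinearMap.mem_ker, Subtype.ext_iff]
  rw [e]
  exact h

/-- quotient field equality -/
theorem quot_iff {u : V} {ρ σ : R} :
    Ideal.Quotient.mk (LinearMap.ker (LinearMap.toSpanSingleton R V u)) ρ =
      Ideal.Quotient.mk (LinearMap.ker (LinearMap.toSpanSingleton R V u)) σ ↔ ρ • u = σ • u := by
  rw [Ideal.Quotient.eq, LinearMap.mem_ker, LinearMap.toSpanSingleton_apply, sub_smul, sub_eq_zero]

/-- Powers of a nontrivial element give the whole action on an atom. -/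
theorem Ctx.cyc (C : Ctx ι L r) {U : Submodule R V} (hU : IsAtom U) {u : V} (hu : u ∈ U)
    (hu0 : u ≠ 0) {z : Q} (hz : ι z • u ≠ u) (q : Q) : ∃ k : ℕ, ι q • u = ι z ^ k • u := by
  let I : Ideal R := LinearMap.ker (LinearMap.toSpanSingleton R V u)
  have hI : I.IsMaximal := atom_max hU hu hu0
  let _ : Field (R ⧸ I) := Ideal.Quotient.field I
  have : NeZero r := ⟨C.hr.ne_zero⟩
  have : Fact r.Prime := ⟨C.hr⟩
  have hp : IsPrimitiveRoot (Ideal.Quotient.mk I (ι z)) r := by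
    rw [← orderOf_eq_prime (x := Ideal.Quotient.mk I (ι z)) (p := r)]
    · exact IsPrimitiveRoot.orderOf _
    · rw [← map_pow, ← map_pow, C.hexp]; simp
    · intro h
      rw [← map_one (Ideal.Quotient.mk I)] at h
      exact hz (by simpa using quot_iff.1 h)
  obtain ⟨k, -, hk⟩ := hp.eq_pow_of_pow_eq_one (ξ := Ideal.Quotient.mk I (ι q))
    (by rw [← map_pow, ← map_pow, C.hexp]; simp)
  refine ⟨k, ?_⟩
  rw [← map_pow] at hk
  exact (quot_iff.1 hk).symm

theorem Ctx.key (C : Ctx ι L r) {x : Equiv.Perm V} (hx : TriP L x) (h0 : x 0 = 0)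
    {U : Submodule R V} (hU : IsAtom U) {u c : V} (hu : u ∈ U) (hu0 : u ≠ 0)
    (hq : ∀ q, x (ι q • u) = ι q • x u) (hc : c ∈ U) (hc0 : c ≠ 0) :
    ∃ h ∈ L, h c = x c ∧ ∀ q, h (ι q • u) = ι q • x u := by
  have hx0 : ∀ v, v ≠ 0 → x v ≠ 0 := fun v hv h => hv (x.injective (h.trans h0.symm))
  have hU' : IsAtom (C.phi x hx h0 U) := (OrderIso.isAtom_iff _ U).2 hU
  have hxu : x u ∈ C.phi x hx h0 U := (C.mem_phi _ _ _ _).2 ⟨u, hu, rfl⟩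
  have hxc : x c ∈ C.phi x hx h0 U := (C.mem_phi _ _ _ _).2 ⟨c, hc, rfl⟩
  obtain ⟨z, hz⟩ : ∃ z, ι z • u ≠ u := by
    by_contra hcon
    push Not at hcon
    exact hu0 (C.hfix u hcon)
  have hzc : ι z • c ≠ c := fun h => hz (by
    simpa using atom_trans hU hc hc0 hu (ρ := ι z) (σ := 1) (by simpa using h))
  have hzxu : ι z • x u ≠ x u := by
    rw [← hq]; exact fun h => hz (x.injective h)
  -- choose the local linear maps
  have hex : ∀ i : ℕ, ∃ h ∈ L, h (ι (z ^ i) • u) = ι (z ^ i) • x u ∧ h c = x c := by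
    intro i
    obtain ⟨h, hh, h1, h2⟩ := hx 0 (ι (z ^ i) • u) c
    refine ⟨h, hh, ?_, ?_⟩
    · rw [sub_zero, h0, sub_zero, hq] at h1; exact h1.symm
    · simpa [h0] using h2.symm
  choose h hh h1 h2 using hex
  have hth : ∀ i : ℕ, ∃ q', ∀ v, h i (ι z • v) = ι q' • h i v := fun i => C.hnorm _ (hh i) z
  choose θ hθ using hth
  have hθk : ∀ i k v, h i (ι z ^ k • v) = ι (θ i) ^ k • h i v := by
    intro i k v
    induction k with
    | zero => simp
    | succ k ih => rw [pow_succ', mul_smul, hθ, ih, smul_smul, ← pow_succ']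
  let I : Ideal R := LinearMap.ker (LinearMap.toSpanSingleton R V (x c))
  have hI : I.IsMaximal := atom_max hU' hxc (hx0 c hc0)
  let _ : Field (R ⧸ I) := Ideal.Quotient.field I
  classical
  -- pigeonhole
  obtain ⟨i, hi, j, hj, hij, heq⟩ : ∃ i ∈ Finset.range r, ∃ j ∈ Finset.range r, i ≠ j ∧
      Ideal.Quotient.mk I (ι (θ i)) = Ideal.Quotient.mk I (ι (θ j)) := by
    refine Finset.exists_ne_map_eq_of_card_lt_of_maps_to
      (t := (Polynomial.nthRootsFinset r (1 : R ⧸ I)).erase 1)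
      (f := fun i => Ideal.Quotient.mk I (ι (θ i))) ?_ ?_
    · rw [Finset.card_erase_of_mem, Finset.card_range]
      · have : (Polynomial.nthRootsFinset r (1 : R ⧸ I)).card ≤ r := by
          unfold Polynomial.nthRootsFinset
          exact (Multiset.toFinset_card_le _).trans (Polynomial.card_nthRoots r 1)
        have := C.hr.pos
        omega
      · rw [Polynomial.mem_nthRootsFinset C.hr.pos]; simp
    · intro i _
      rw [Finset.mem_coe, Finset.mem_erase, Polynomial.mem_nthRootsFinset C.hr.pos]
      constructor
      · intro hcon
        rw [← map_one (Ideal.Quotient.mk I)] at hcon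
        have h3 := quot_iff.1 hcon
        rw [← h2 i, ← hθ, one_smul] at h3
        exact hzc ((h i).injective h3)
      · rw [← map_pow, ← map_pow, C.hexp]; simp
  have heqc := quot_iff.1 heq
  -- `h i` and `h j` agree on `U`
  have hpow : ∀ k : ℕ, ι (θ i) ^ k • x c = ι (θ j) ^ k • x c := by
    intro k
    apply quot_iff.1
    rw [map_pow, map_pow, heq]
  have hagree : ∀ v ∈ U, h i v = h j v := by
    intro v hv
    obtain ⟨ρ, rfl⟩ := atom_scale hU hc hc0 hv
    have hρ : ρ ∈ AddSubgroup.closure (Set.range ι) := by rw [C.hspan]; trivial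
    clear hv
    induction hρ using AddSubgroup.closure_induction with
    | mem y hy =>
      obtain ⟨q, rfl⟩ := hy
      obtain ⟨k, hk⟩ := C.cyc hU hc hc0 hzc q
      rw [hk, hθk, hθk, h2, h2, hpow]
    | zero => simp
    | add a b _ _ ha hb => rw [add_smul, map_add, map_add, ha, hb]
    | neg a _ ha => rw [neg_smul, map_neg, map_neg, ha]
  have hxupow : ∀ k : ℕ, ι z ^ k • x u ∈ C.phi x hx h0 U := fun k => Submodule.smul_mem _ _ hxu
  -- `θ i` acts as `z`
  have main : ∀ i j : ℕ, i < r → j < r → i < j → (∀ v ∈ U, h i v = h j v) →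
      ι (θ i) • x u = ι z • x u := by
    intro i j hi hj hij hagree
    obtain ⟨k, rfl⟩ := Nat.exists_eq_add_of_lt hij
    have e1 : ι (θ i) ^ (k + 1) • ι z ^ i • x u = ι z ^ (k + 1) • ι z ^ i • x u := by
      have a1 := h1 (i + k + 1)
      rw [← hagree _ (U.smul_mem _ hu), add_assoc, add_comm, pow_add, map_mul, map_pow, map_pow,
        mul_smul, hθk, ← map_pow ι z i, h1 i, mul_smul] at a1
      simpa using a1
    have hz0 : ι z ^ i • x u ≠ 0 := by
      rw [← map_pow, ← hq]
      apply hx0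
      intro hzero
      have : ι (z ^ i)⁻¹ • ι (z ^ i) • u = 0 := by rw [hzero, smul_zero]
      rw [smul_smul, ← map_mul] at this
      exact hu0 (by simpa using this)
    have e2 := atom_trans hU' (hxupow i) hz0 hxu e1
    let J : Ideal R := LinearMap.ker (LinearMap.toSpanSingleton R V (x u))
    have e3 : Ideal.Quotient.mk J (ι (θ i ^ (k + 1))) = Ideal.Quotient.mk J (ι (z ^ (k + 1))) := by
      apply quot_iff.2; simpa using e2
    have hcop : Nat.Coprime (k + 1) r := by
      apply Nat.Coprime.symm
      rw [C.hr.coprime_iff_not_dvd]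
      intro hd
      have := Nat.le_of_dvd (by omega) hd
      omega
    obtain ⟨m, hm⟩ : ∃ m, (k + 1) * m % r = 1 % r := by
      obtain ⟨m, -, hm⟩ := Nat.exists_mul_mod_eq_one_of_coprime hcop C.hr.one_lt
      exact ⟨m, by rw [hm, Nat.mod_eq_of_lt C.hr.one_lt]⟩
    have hpm : ∀ q : Q, q ^ ((k + 1) * m) = q := by
      intro q
      have ho : orderOf q ∣ r := orderOf_dvd_of_pow_eq_one (C.hexp q)
      conv_rhs => rw [← pow_one q]
      rw [pow_eq_pow_iff_modEq]
      exact Nat.ModEq.of_dvd ho hm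
    have e4 : Ideal.Quotient.mk J (ι (θ i)) = Ideal.Quotient.mk J (ι z) := by
      rw [← hpm (θ i), ← hpm z, pow_mul, pow_mul, map_pow ι, map_pow ι _ m, map_pow, map_pow _ _ m, e3]
    exact quot_iff.1 e4
  obtain ⟨i, hzi⟩ : ∃ i, ι (θ i) • x u = ι z • x u := by
    rw [Finset.mem_range] at hi hj
    rcases lt_or_gt_of_ne hij with hlt | hlt
    · exact ⟨i, main i j hi hj hlt hagree⟩
    · exact ⟨j, main j i hj hi hlt fun v hv => (hagree v hv).symm⟩
  refine ⟨h i, hh i, h2 i, ?_⟩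
  have hcom : ∀ k : ℕ, ι (θ i) ^ k • x u = ι z ^ k • x u := by
    intro k
    apply quot_iff.1
    rw [map_pow, map_pow, quot_iff.2 hzi]
  have hiu : h i u = x u := by
    have a1 := h1 i
    rw [map_pow, hθk] at a1
    -- multiply by the inverse power
    have hmem : h i u ∈ C.phi x hx h0 U := by
      obtain ⟨ρ, hρ⟩ := atom_scale hU hc hc0 hu
      have : ∀ ρ : R, h i (ρ • c) ∈ C.phi x hx h0 U := by
        intro ρ
        have hρ : ρ ∈ AddSubgroup.closure (Set.range ι) := by rw [C.hspan]; trivial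
        induction hρ using AddSubgroup.closure_induction with
        | mem y hy =>
          obtain ⟨q, rfl⟩ := hy
          obtain ⟨q', hq'⟩ := C.hnorm _ (hh i) q
          rw [hq', h2]
          exact Submodule.smul_mem _ _ hxc
        | zero => simp
        | add a b _ _ ha hb => rw [add_smul, map_add]; exact Submodule.add_mem _ ha hb
        | neg a _ ha => rw [neg_smul, map_neg]; exact Submodule.neg_mem _ ha
      rw [← hρ]; exact this ρ
    rw [atom_trans hU' hxu (hx0 u hu0) hmem (hcom i)] at a1
    have := congrArg (fun v => ι (z ^ i)⁻¹ • v) a1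
    simp only [← map_pow ι, smul_smul, ← map_mul] at this
    simpa using this
  intro q
  obtain ⟨k, hk⟩ := C.cyc hU hu hu0 hz q
  rw [← hq q, hk, hθk, hiu, hcom, ← map_pow, hq]

theorem Ctx.linear (C : Ctx ι L r) {x : Equiv.Perm V} (hx : TriP L x) (h0 : x 0 = 0)
    {U : Submodule R V} (hU : IsAtom U) {u : V} (hu : u ∈ U) (hu0 : u ≠ 0)
    (hq : ∀ q, x (ι q • u) = ι q • x u) (ρ : R) : x (ρ • u) = ρ • x u := by
  have hext : ∀ h : V ≃+ V, (∀ q, h (ι q • u) = ι q • x u) → ∀ ρ : R, h (ρ • u) = ρ • x u := by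
    intro h hh ρ
    have hρ : ρ ∈ AddSubgroup.closure (Set.range ι) := by rw [C.hspan]; trivial
    induction hρ using AddSubgroup.closure_induction with
    | mem y hy => obtain ⟨q, rfl⟩ := hy; exact hh q
    | zero => simp
    | add a b _ _ ha hb => rw [add_smul, map_add, ha, hb, add_smul]
    | neg a _ ha => rw [neg_smul, map_neg, ha, neg_smul]
  by_cases hc0 : ρ • u = 0
  · obtain ⟨h, -, -, h2⟩ := C.key hx h0 hU hu hu0 hq hu hu0
    have := hext h h2 ρ
    rw [hc0, map_zero] at this
    rw [hc0, h0, this]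
  · obtain ⟨h, -, h1, h2⟩ := C.key hx h0 hU hu hu0 hq (U.smul_mem ρ hu) hc0
    rw [← h1, hext h h2]

theorem Ctx.fixAtom [IsSemisimpleModule R V] (C : Ctx ι L r) {x : Equiv.Perm V} (hx : TriP L x)
    (h0 : x 0 = 0) {δ : V} (hδ : ∀ q, x (ι q • δ) = ι q • δ) {U : Submodule R V} (hU : IsAtom U)
    (hle : U ≤ R ∙ δ) : ∀ c ∈ U, x c = c := by
  have hδ1 : x δ = δ := by simpa using hδ 1
  let φ := C.phi x hx h0
  have hφN : φ (R ∙ δ) = R ∙ δ := by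
    have hle' : R ∙ δ ≤ φ (R ∙ δ) := by
      rw [Submodule.span_singleton_le_iff_mem, C.mem_phi]
      exact ⟨δ, Submodule.mem_span_singleton_self δ, hδ1⟩
    symm
    apply SetLike.coe_injective
    apply Set.eq_of_subset_of_ncard_le hle'
    rw [C.coe_phi, Set.ncard_image_of_injective _ x.injective]
  obtain ⟨W, hW⟩ := exists_isCompl U
  have htop : δ ∈ U ⊔ W := by rw [hW.sup_eq_top]; trivial
  obtain ⟨u, hu, w, hw, huw⟩ := Submodule.mem_sup.1 htop
  have hu0 : u ≠ 0 := by
    rintro rfl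
    rw [zero_add] at huw
    subst huw
    have : U ≤ W := hle.trans (by simpa using hw)
    exact hU.1 (hW.disjoint.eq_bot_of_le this)
  have hU' : IsAtom (φ U) := (OrderIso.isAtom_iff φ U).2 hU
  have hdis : Disjoint (φ U) (φ W) := by
    rw [disjoint_iff, ← OrderIso.map_inf, hW.inf_eq_bot, OrderIso.map_bot]
  have hxu : ∀ v ∈ U, x v ∈ φ U := fun v hv => (C.mem_phi _ _ _ _).2 ⟨v, hv, rfl⟩
  have hxw : ∀ v ∈ W, x v ∈ φ W := fun v hv => (C.mem_phi _ _ _ _).2 ⟨v, hv, rfl⟩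
  have hsplit : ∀ a ∈ U, ∀ b ∈ W, x (a + b) = x a + x b := by
    intro a ha b hb
    rw [add_comm, C.addSub hU hW.disjoint ha hb hx h0, add_comm]
  have huniq : ∀ a ∈ φ U, ∀ a' ∈ φ U, ∀ b ∈ φ W, ∀ b' ∈ φ W, a + b = a' + b' → a = a' := by
    intro a ha a' ha' b hb b' hb' h
    have e : a - a' = b' - b := by
      rw [sub_eq_sub_iff_add_eq_add, h, add_comm]
    have := (Submodule.disjoint_def.1 hdis) (a - a') (Submodule.sub_mem _ ha ha')
      (e ▸ Submodule.sub_mem _ hb' hb)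
    exact sub_eq_zero.1 this
  have hδ' : x u + x w = δ := by rw [← hsplit u hu w hw, huw, hδ1]
  have hq : ∀ q, x (ι q • u) = ι q • x u := by
    intro q
    refine huniq _ (hxu _ (U.smul_mem _ hu)) _ (Submodule.smul_mem _ _ (hxu _ hu))
      (x (ι q • w)) (hxw _ (W.smul_mem _ hw)) (ι q • x w) (Submodule.smul_mem _ _ (hxw _ hw)) ?_
    rw [← hsplit _ (U.smul_mem _ hu) _ (W.smul_mem _ hw), ← smul_add, ← smul_add, huw, hδ', hδ]
  have hlin := C.linear hx h0 hU hu hu0 hq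
  obtain ⟨ε, hε⟩ := Submodule.mem_span_singleton.1 (hle hu)
  have hεu : ε • u = u := by
    have e : ε • u - u = - (ε • w) := by
      rw [sub_eq_iff_eq_add, neg_add_eq_sub, eq_sub_iff_add_eq, ← smul_add, huw, hε]
    have := (Submodule.disjoint_def.1 hW.disjoint) (ε • u - u)
      (U.sub_mem (U.smul_mem _ hu) hu) (e ▸ W.neg_mem (W.smul_mem _ hw))
    exact sub_eq_zero.1 this
  have hεxu : ε • x u = x u := by rw [← hlin, hεu]
  have hxuN : x u ∈ R ∙ δ := by
    rw [← hφN]; exact (C.mem_phi _ _ _ _).2 ⟨u, hle hu, rfl⟩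
  obtain ⟨τ, hτ⟩ := Submodule.mem_span_singleton.1 hxuN
  have hxuU : x u ∈ U := by
    rw [← hεxu, ← hτ, smul_comm, hε]; exact U.smul_mem _ hu
  have hx0 : x u ≠ 0 := fun h => hu0 (x.injective (h.trans h0.symm))
  have hUU : φ U = U := by
    by_contra hne
    exact hx0 ((Submodule.disjoint_def.1 (hU'.disjoint_of_ne hU hne)) _ (hxu u hu) hxuU)
  have hfin : x u = u := by
    have e : ε • x w = u - x u := by
      have e0 : ε • (x u + x w) = u := by rw [hδ', hε]
      rw [smul_add, hεxu] at e0
      rw [eq_sub_iff_add_eq, add_comm, e0]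
    have := (Submodule.disjoint_def.1 hdis) (u - x u)
      (by rw [hUU]; exact U.sub_mem hu hxuU) (e ▸ Submodule.smul_mem _ _ (hxw _ hw))
    exact (sub_eq_zero.1 this).symm
  intro c hc
  obtain ⟨ρ, rfl⟩ := atom_scale hU hu hu0 hc
  rw [hlin, hfin]

theorem Ctx.final [IsSemisimpleModule R V] (C : Ctx ι L r) {x : Equiv.Perm V} (hx : TriP L x)
    (h0 : x 0 = 0) (D : Set V) (hD : ∀ δ ∈ D, ∀ q, x (ι q • δ) = ι q • δ)
    (hsp : Submodule.span R D = ⊤) : ∀ v, x v = v := by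
  have : Finite (Submodule R V) := inferInstance
  obtain ⟨W, hW⟩ := Set.Finite.exists_maximal
    (s := {W : Submodule R V | ∀ w ∈ W, x w = w}) (Set.toFinite _) ⟨⊥, by simp [h0]⟩
  have htop : W = ⊤ := by
    rw [eq_top_iff, ← hsp, Submodule.span_le]
    intro δ hδ
    rw [SetLike.mem_coe, ← Submodule.span_singleton_le_iff_mem, ← sSup_atoms_le_eq (R ∙ δ)]
    apply sSup_le
    rintro U ⟨hU, hle⟩
    by_contra hUW
    have hdis : Disjoint U W := (hU.not_le_iff_disjoint).1 hUW
    have hfix := C.fixAtom hx h0 (hD δ hδ) hU hle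
    have : W ⊔ U ≤ W := hW.2 (y := W ⊔ U) (by
      intro v hv
      obtain ⟨w, hw, u, hu, rfl⟩ := Submodule.mem_sup.1 hv
      rw [C.addSub hU hdis hu hw hx h0, hfix u hu, hW.1 w hw]) le_sup_left
    exact hUW (le_sup_right.trans this)
  intro v
  exact hW.1 v (by rw [htop]; trivial)

end core

theorem core_two {V : Type} [AddCommGroup V] [Finite V] [Module (ZMod 2) V]
    (Qs : Subgroup (Equiv.Perm V)) (hadd : ∀ q ∈ Qs, ∀ u v, q (u + v) = q u + q v)
    (hcomm : ∀ a ∈ Qs, ∀ b ∈ Qs, a * b = b * a) {r : ℕ} (hr : r.Prime)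
    (hexp : ∀ q ∈ Qs, q ^ r = 1) (hfix : ∀ v : V, (∀ q ∈ Qs, q v = v) → v = 0)
    (hodd : Odd (Nat.card Qs)) (L : Set (V ≃+ V)) (hsymm : ∀ h ∈ L, h.symm ∈ L)
    (hnorm : ∀ h ∈ L, ∀ q ∈ Qs, ∃ q' ∈ Qs, ∀ v, h (q v) = q' (h v))
    (x : Equiv.Perm V) (hx : TriP L x) (h0 : x 0 = 0) (D : Set V)
    (hD : ∀ δ ∈ D, ∀ q ∈ Qs, x (q δ) = q δ)
    (hsp : ∀ W : AddSubgroup V, D ⊆ W → W = ⊤) : ∀ v, x v = v := by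
  let _ : CommGroup Qs :=
    { (inferInstance : Group Qs) with
      mul_comm := fun a b => Subtype.ext (hcomm a.1 a.2 b.1 b.2) }
  let ρ : Qs →* Module.End (ZMod 2) V :=
    { toFun := fun q => AddMonoidHom.toZModLinearMap 2
        { toFun := q.1, map_zero' := by simpa using hadd q.1 q.2 0 0
          map_add' := hadd q.1 q.2 }
      map_one' := by ext v; rfl
      map_mul' := fun a b => by ext v; rfl }
  let f := MonoidAlgebra.lift (ZMod 2) (Module.End (ZMod 2) V) Qs ρ
  let _ : Module (MonoidAlgebra (ZMod 2) Qs) V := Module.compHom V f.toRingHom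
  have hof : ∀ (q : Qs) (v : V), MonoidAlgebra.of (ZMod 2) Qs q • v = q.1 v := by
    intro q v
    change f (MonoidAlgebra.of (ZMod 2) Qs q) v = q.1 v
    simp only [f, MonoidAlgebra.lift_of]
    rfl
  have : NeZero (Nat.card Qs : ZMod 2) := ⟨by
    rw [Ne, ZMod.natCast_eq_zero_iff]
    exact fun h => (Nat.not_even_iff_odd.2 hodd) (even_iff_two_dvd.2 h)⟩
  have : IsSemisimpleRing (MonoidAlgebra (ZMod 2) Qs) := inferInstance
  have : IsSemisimpleModule (MonoidAlgebra (ZMod 2) Qs) V := inferInstance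
  have C : Ctx (R := MonoidAlgebra (ZMod 2) Qs) (V := V) (MonoidAlgebra.of (ZMod 2) Qs) L r :=
    { hspan := by
        rw [eq_top_iff]
        intro a _
        induction a using MonoidAlgebra.induction_linear with
        | zero => exact AddSubgroup.zero_mem _
        | add a b ha hb => exact AddSubgroup.add_mem _ (ha trivial) (hb trivial)
        | single q c =>
          have hc : ∀ c : ZMod 2, c = 0 ∨ c = 1 := by decide
          rcases hc c with rfl | rfl
          · simp
          · exact AddSubgroup.subset_closure ⟨q, rfl⟩
      hr := hr
      hexp := fun q => Subtype.ext (hexp q.1 q.2)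
      hfix := fun v hv => hfix v fun q hq => by rw [← hof ⟨q, hq⟩]; exact hv _
      h2 := fun v => by
        rw [← two_smul (ZMod 2) v]
        have : (2 : ZMod 2) = 0 := by decide
        rw [this, zero_smul]
      hodd := hodd
      hsymm := hsymm
      hnorm := fun h hh q => by
        obtain ⟨q', hq', e⟩ := hnorm h hh q.1 q.2
        exact ⟨⟨q', hq'⟩, fun v => by rw [hof, hof, e]⟩ }
  refine C.final hx h0 D (fun δ hδ q => by rw [hof]; exact hD δ hδ q.1 q.2) ?_
  rw [← Submodule.toAddSubgroup_inj]
  exact hsp _ Submodule.subset_span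

theorem solv_aux {Γ : Type*} [Group Γ] [Finite Γ] [Group.IsSolvable Γ] [Nontrivial Γ] :
    ∃ (r : ℕ) (N : Subgroup Γ), r.Prime ∧ N.Normal ∧ N ≠ ⊥ ∧ (∀ a ∈ N, ∀ b ∈ N, a * b = b * a) ∧
      ∀ a ∈ N, a ^ r = 1 := by
  classical
  have hex : ∃ n, derivedSeries Γ n = ⊥ := Group.IsSolvable.solvable
  obtain ⟨n, hn⟩ : ∃ n, Nat.find hex = n + 1 := by
    refine Nat.exists_eq_succ_of_ne_zero fun h => ?_
    have := Nat.find_spec hex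
    rw [h, derivedSeries_zero] at this
    exact top_ne_bot this
  have hbot : ⁅derivedSeries Γ n, derivedSeries Γ n⁆ = ⊥ := by
    rw [← derivedSeries_succ, ← hn]; exact Nat.find_spec hex
  have hne : derivedSeries Γ n ≠ ⊥ := Nat.find_min hex (by omega)
  have hnorm : (derivedSeries Γ n).Normal := inferInstance
  generalize derivedSeries Γ n = A at hbot hne hnorm
  have hcom : ∀ a ∈ A, ∀ b ∈ A, a * b = b * a := by
    intro a ha b hb
    have := (Subgroup.commutator_eq_bot_iff_le_centralizer.1 hbot) ha
    exact ((Subgroup.mem_centralizer_iff.1 this) b hb).symm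
  have hcard : Nat.card A ≠ 1 := fun h => hne (Subgroup.card_eq_one.1 h)
  obtain ⟨r, hr, hrd⟩ := Nat.exists_prime_and_dvd hcard
  have : Fact r.Prime := ⟨hr⟩
  obtain ⟨a, ha⟩ := exists_prime_orderOf_dvd_card' (G := A) r hrd
  let N : Subgroup Γ :=
    { carrier := {a | a ∈ A ∧ a ^ r = 1}
      one_mem' := ⟨A.one_mem, one_pow r⟩
      mul_mem' := by
        rintro a b ⟨ha, ha'⟩ ⟨hb, hb'⟩
        refine ⟨A.mul_mem ha hb, ?_⟩
        rw [(show Commute a b from hcom a ha b hb).mul_pow, ha', hb', one_mul]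
      inv_mem' := by
        rintro a ⟨ha, ha'⟩
        exact ⟨A.inv_mem ha, by rw [inv_pow, ha', inv_one]⟩ }
  refine ⟨r, N, hr, ⟨?_⟩, ?_, ?_, ?_⟩
  · rintro a ⟨ha, ha'⟩ g
    exact ⟨hnorm.conj_mem a ha g, by rw [conj_pow, ha']; simp⟩
  · intro h
    have hmem : a.1 ∈ (⊥ : Subgroup Γ) := by
      rw [← h]
      refine ⟨a.2, ?_⟩
      have := pow_orderOf_eq_one a
      rw [ha] at this
      exact congrArg Subtype.val this
    rw [Subgroup.mem_bot] at hmem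
    have : a = 1 := Subtype.ext hmem
    rw [this, orderOf_one] at ha
    exact hr.one_lt.ne ha
  · rintro a ⟨ha, -⟩ b ⟨hb, -⟩
    exact hcom a ha b hb
  · rintro a ⟨-, ha⟩
    exact ha

def Tri {V : Type} (G : Subgroup (Equiv.Perm V)) (x : Equiv.Perm V) : Prop :=
  ∀ a b c, ∃ g ∈ G, g a = x a ∧ g b = x b ∧ g c = x c

/-- Irreducibility of the zero stabilizer, phrased with additive subgroups. -/
def IrrG {V : Type} [AddCommGroup V] (G : Subgroup (Equiv.Perm V)) : Prop :=
  ∀ W : AddSubgroup V, (∀ g ∈ G, g 0 = 0 → ∀ w ∈ W, g w ∈ W) → W = ⊥ ∨ W = ⊤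

def AffG {V : Type} [AddCommGroup V] (G : Subgroup (Equiv.Perm V)) : Prop :=
  ∀ g ∈ G, ∀ u v, g (u + v) = g u + g v - g 0

theorem AffG.sub {V : Type} [AddCommGroup V] {G : Subgroup (Equiv.Perm V)} (h : AffG G)
    {g : Equiv.Perm V} (hg : g ∈ G) (a b : V) : g (a - b) = g a - g b + g 0 := by
  have := h g hg (a - b) b
  rw [sub_add_cancel] at this
  rw [this]; abel

theorem fixW {V : Type} [AddCommGroup V] {G : Subgroup (Equiv.Perm V)} (hirr : IrrG G)
    (K : Subgroup (Equiv.Perm V)) (hK : ∀ k ∈ K, ∀ u v, k (u + v) = k u + k v)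
    (hn : ∀ h ∈ G, h 0 = 0 → ∀ k ∈ K, h⁻¹ * k * h ∈ K)
    (haff : AffG G) :
    (∀ v, (∀ k ∈ K, k v = v) → v = 0) ∨ ∀ k ∈ K, k = 1 := by
  have hk0 : ∀ k ∈ K, k 0 = 0 := fun k hk => by simpa using hK k hk 0 0
  let W : AddSubgroup V :=
    { carrier := {v | ∀ k ∈ K, k v = v}
      zero_mem' := hk0
      add_mem' := fun {a b} ha hb k hk => by rw [hK k hk, ha k hk, hb k hk]
      neg_mem' := fun {a} ha k hk => by
        have := hK k hk a (-a)
        rw [add_neg_cancel, hk0 k hk, ha k hk] at this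
        exact (neg_eq_of_add_eq_zero_right this.symm).symm }
  rcases hirr W (fun g hg h0 w hw k hk => by
      have h1 := hw _ (hn g hg h0 k hk)
      have h2 : g ((g⁻¹ * k * g) w) = k (g w) := by simp [Equiv.Perm.mul_apply]
      rw [← h2, h1]) with h | h
  · left
    intro v hv
    have : v ∈ W := hv
    rw [h] at this
    exact this
  · right
    intro k hk
    ext v
    have : v ∈ W := by rw [h]; trivial
    exact this k hk

theorem pfix {V : Type} [AddCommGroup V] [Finite V] {p : ℕ} (hp : p.Prime)
    (hdvd : p ∣ Nat.card V) (K : Subgroup (Equiv.Perm V)) (hk0 : ∀ k ∈ K, k 0 = 0)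
    (hpK : IsPGroup p K) : ∃ v : V, v ≠ 0 ∧ ∀ k ∈ K, k v = v := by
  have : Fact p.Prime := ⟨hp⟩
  obtain ⟨b, hb, hne⟩ := hpK.exists_fixed_point_of_prime_dvd_card_of_fixed_point V hdvd
    (a := 0) (fun k => hk0 k.1 k.2)
  exact ⟨b, hne.symm, fun k hk => hb ⟨k, hk⟩⟩

theorem transl {V : Type} [AddCommGroup V] [Finite V] [Nontrivial V] {p d : ℕ} (hp : p.Prime)
    (hd : 1 ≤ d) (hcard : Nat.card V = p ^ d) {G : Subgroup (Equiv.Perm V)} (hirr : IrrG G)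
    (haff : AffG G) (hsolv : Group.IsSolvable G) (hprim : IsPrimitiveSubgroup G) (w : V) :
    Equiv.addRight w ∈ G := by
  have : Nontrivial G := by
    obtain ⟨a, b, hab⟩ := exists_pair_ne V
    obtain ⟨g, hg, e⟩ := hprim.1 a b
    refine ⟨⟨⟨g, hg⟩, 1, fun h => hab ?_⟩⟩
    have : g = 1 := congrArg Subtype.val h
    rw [← e, this]; rfl
  obtain ⟨r, N', -, hNn, hNe, hNc, -⟩ := solv_aux (Γ := G)
  obtain ⟨N, hNG, hnorm, hcom, n₀, hn₀, hn₀1⟩ : ∃ N : Subgroup (Equiv.Perm V), N ≤ G ∧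
      (∀ g ∈ G, ∀ n ∈ N, g * n * g⁻¹ ∈ N) ∧ (∀ a ∈ N, ∀ b ∈ N, a * b = b * a) ∧
      ∃ n ∈ N, n ≠ 1 := by
    refine ⟨N'.map G.subtype, ?_, ?_, ?_, ?_⟩
    · rintro _ ⟨a, -, rfl⟩; exact a.2
    · rintro g hg _ ⟨a, ha, rfl⟩
      exact ⟨_, hNn.conj_mem a ha ⟨g, hg⟩, rfl⟩
    · rintro _ ⟨a, ha, rfl⟩ _ ⟨b, hb, rfl⟩
      exact congrArg Subtype.val (hNc a ha b hb)
    · obtain ⟨a, hne⟩ := Subgroup.ne_bot_iff_exists_ne_one.1 hNe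
      exact ⟨a.1.1, ⟨a.1, a.2, rfl⟩, fun e => hne (Subtype.ext (Subtype.ext e))⟩
  have hnorm' : ∀ g ∈ G, ∀ n ∈ N, g⁻¹ * n * g ∈ N := fun g hg n hn => by
    simpa using hnorm g⁻¹ (G.inv_mem hg) n hn
  have hB : ∀ v : V, ∃ n ∈ N, n 0 = v := by
    rcases hprim.2 {v | ∃ n ∈ N, n 0 = v} (fun g hg => by
      by_cases hdis : Disjoint (g '' {v | ∃ n ∈ N, n 0 = v}) {v | ∃ n ∈ N, n 0 = v}
      · exact Or.inr hdis
      left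
      rw [Set.not_disjoint_iff] at hdis
      obtain ⟨_, ⟨_, ⟨n, hn, rfl⟩, rfl⟩, n', hn', e⟩ := hdis
      have hm : g 0 = ((g * n * g⁻¹)⁻¹ * n') 0 := by
        rw [Equiv.Perm.mul_apply, e]; simp
      have hmN : (g * n * g⁻¹)⁻¹ * n' ∈ N := N.mul_mem (N.inv_mem (hnorm g hg n hn)) hn'
      generalize (g * n * g⁻¹)⁻¹ * n' = m at hm hmN
      ext v
      constructor
      · rintro ⟨_, ⟨k, hk, rfl⟩, rfl⟩
        refine ⟨g * k * g⁻¹ * m, N.mul_mem (hnorm g hg k hk) hmN, ?_⟩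
        rw [Equiv.Perm.mul_apply, ← hm]; simp
      · rintro ⟨k, hk, rfl⟩
        refine ⟨_, ⟨g⁻¹ * (k * m⁻¹) * g, hnorm' g hg _ (N.mul_mem hk (N.inv_mem hmN)), rfl⟩, ?_⟩
        simp [hm]) with h | h
    · exfalso
      apply hn₀1
      ext v
      obtain ⟨g, hg, rfl⟩ := hprim.1 0 v
      have h1 : (g⁻¹ * n₀ * g) 0 = 0 :=
        h ⟨_, hnorm' g hg _ hn₀, rfl⟩ ⟨1, N.one_mem, rfl⟩
      have h2 : g ((g⁻¹ * n₀ * g) 0) = n₀ (g 0) := by simp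
      rw [← h2, h1]; rfl
    · intro v
      have : v ∈ {v | ∃ n ∈ N, n 0 = v} := by rw [h]; trivial
      exact this
  have hreg : ∀ n ∈ N, n 0 = 0 → n = 1 := by
    intro n hn h0
    ext v
    obtain ⟨m, hm, rfl⟩ := hB v
    rw [← Equiv.Perm.mul_apply, hcom n hn m hm, Equiv.Perm.mul_apply, h0]; rfl
  have hNcard : Nat.card N = p ^ d := by
    rw [← hcard]
    refine Nat.card_congr (Equiv.ofBijective (fun n : N => n.1 0) ⟨?_, ?_⟩)
    · intro a b hab
      have hab : a.1 0 = b.1 0 := hab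
      have := hreg (b.1⁻¹ * a.1) (N.mul_mem (N.inv_mem b.2) a.2) (by
        rw [Equiv.Perm.mul_apply, hab]; simp)
      exact Subtype.ext (inv_mul_eq_one.1 this).symm
    · intro v
      obtain ⟨n, hn, e⟩ := hB v
      exact ⟨⟨n, hn⟩, e⟩
  have hNpow : ∀ n ∈ N, n ^ (p ^ d) = 1 := by
    intro n hn
    have := pow_card_eq_one' (G := N) (x := ⟨n, hn⟩)
    rw [hNcard] at this
    exact congrArg Subtype.val this
  let K : Subgroup (Equiv.Perm V) :=
    { carrier := {k | ∃ n ∈ N, ∀ v, k v = n v - n 0}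
      one_mem' := ⟨1, N.one_mem, fun v => by simp⟩
      mul_mem' := by
        rintro a b ⟨m, hm, ea⟩ ⟨n, hn, eb⟩
        refine ⟨m * n, N.mul_mem hm hn, fun v => ?_⟩
        rw [Equiv.Perm.mul_apply, eb, ea, haff.sub (hNG hm)]
        simp
      inv_mem' := by
        rintro a ⟨m, hm, ea⟩
        refine ⟨m⁻¹, N.inv_mem hm, fun v => ?_⟩
        rw [Equiv.Perm.inv_eq_iff_eq, ea, haff.sub (hNG hm)]
        simp }
  have hKadd : ∀ k ∈ K, ∀ u v, k (u + v) = k u + k v := by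
    rintro k ⟨n, hn, e⟩ u v
    rw [e, e, e, haff n (hNG hn)]; abel
  have hKp : IsPGroup p K := by
    rintro ⟨k, n, hn, e⟩
    refine ⟨d, Subtype.ext ?_⟩
    change k ^ p ^ d = 1
    have : ∀ j : ℕ, ∀ v, (k ^ j) v = (n ^ j) v - (n ^ j) 0 := by
      intro j
      induction j with
      | zero => intro v; simp
      | succ j ih =>
        intro v
        rw [pow_succ', Equiv.Perm.mul_apply, ih, e, haff.sub (hNG hn), pow_succ']
        simp
    ext v
    rw [this, hNpow n hn]; simp
  have hKn : ∀ h ∈ G, h 0 = 0 → ∀ k ∈ K, h⁻¹ * k * h ∈ K := by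
    rintro h hh h0 k ⟨n, hn, e⟩
    refine ⟨h⁻¹ * n * h, hnorm' h hh n hn, fun v => ?_⟩
    have h0' : h⁻¹ 0 = 0 := by rw [Equiv.Perm.inv_eq_iff_eq, h0]
    simp only [Equiv.Perm.mul_apply]
    rw [e, haff.sub (G.inv_mem hh), h0, h0', add_zero]
  have hK1 : ∀ k ∈ K, k = 1 := by
    rcases fixW hirr K hKadd hKn haff with h | h
    · obtain ⟨v, hv, hf⟩ := pfix hp (hcard ▸ dvd_pow_self p (by omega)) K
        (fun k hk => by simpa using hKadd k hk 0 0) hKp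
      exact absurd (h v hf) hv
    · exact h
  obtain ⟨n, hn, e⟩ := hB w
  have h1 : Equiv.subRight (n 0) * n = 1 := hK1 _ ⟨n, hn, fun v => rfl⟩
  have h2 : n = Equiv.addRight w := by
    ext v
    have := congrArg (fun k : Equiv.Perm V => k v) h1
    have : n v - n 0 = v := this
    rw [e] at this
    exact eq_add_of_sub_eq this
  exact h2 ▸ hNG hn

theorem spanD {V : Type} [AddCommGroup V] {G : Subgroup (Equiv.Perm V)} (hirr : IrrG G)
    (haff : AffG G) {α : V} (hα : α ≠ 0) (W : AddSubgroup V)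
    (hW : ∀ g ∈ G, g 0 = 0 → g α ∈ W) : W = ⊤ := by
  have hadd : ∀ g ∈ G, g 0 = 0 → ∀ u v, g (u + v) = g u + g v := fun g hg h0 u v => by
    rw [haff g hg, h0, sub_zero]
  rcases hirr (AddSubgroup.closure {v | ∃ g ∈ G, g 0 = 0 ∧ g α = v}) (by
    intro g hg h0 w hw
    induction hw using AddSubgroup.closure_induction with
    | mem v hv =>
      obtain ⟨k, hk, hk0, rfl⟩ := hv
      exact AddSubgroup.subset_closure ⟨g * k, G.mul_mem hg hk, by simp [hk0, h0], rfl⟩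
    | zero => rw [h0]; exact AddSubgroup.zero_mem _
    | add a b _ _ ha hb => rw [hadd g hg h0]; exact AddSubgroup.add_mem _ ha hb
    | neg a _ ha =>
      have : g (-a) = - g a := by
        have := hadd g hg h0 a (-a)
        rw [add_neg_cancel, h0] at this
        exact (neg_eq_of_add_eq_zero_right this.symm).symm
      rw [this]; exact AddSubgroup.neg_mem _ ha) with h | h
  · exfalso
    have : α ∈ AddSubgroup.closure {v | ∃ g ∈ G, g 0 = 0 ∧ g α = v} :=
      AddSubgroup.subset_closure ⟨1, G.one_mem, rfl, rfl⟩
    rw [h] at this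
    exact hα this
  · rw [eq_top_iff, ← h, AddSubgroup.closure_le]
    rintro _ ⟨g, hg, h0, rfl⟩
    exact hW g hg h0

theorem main_odd {V : Type} [AddCommGroup V] {G : Subgroup (Equiv.Perm V)} (hirr : IrrG G)
    (haff : AffG G) (hhalf : ∀ v : V, ∃ b, b + b = v) {α : V} (hα : α ≠ 0) {x : Equiv.Perm V}
    (hx : Tri G x) (h0 : x 0 = 0) (hD : ∀ g ∈ G, g 0 = 0 → x (g α) = g α) : x = 1 := by
  have hmid : ∀ a b c, b + b = a + c → x a + x c = x b + x b := by
    intro a b c h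
    obtain ⟨g, hg, ea, eb, ec⟩ := hx a b c
    have h1 := haff g hg a c
    have h2 := haff g hg b b
    rw [h, h1, sub_left_inj] at h2
    rw [← ea, ← eb, ← ec, h2]
  have hadd : ∀ a c, x (a + c) = x a + x c := by
    intro a c
    obtain ⟨b, hb⟩ := hhalf (a + c)
    rw [hmid a b c hb, ← hmid 0 b (a + c) (by rw [zero_add, hb]), h0, zero_add]
  let W : AddSubgroup V :=
    { carrier := {v | x v = v}
      zero_mem' := h0
      add_mem' := fun {a b} ha hb => by
        change x (a + b) = a + b
        rw [hadd, ha, hb]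
      neg_mem' := fun {a} ha => by
        have ha : x a = a := ha
        have := hadd a (-a)
        rw [add_neg_cancel, h0, ha] at this
        exact (neg_eq_of_add_eq_zero_right this.symm).symm }
  have := spanD hirr haff hα W hD
  ext v
  have hv : v ∈ W := by rw [this]; trivial
  exact hv

theorem main_two {V : Type} [AddCommGroup V] [Finite V] [Module (ZMod 2) V]
    {G : Subgroup (Equiv.Perm V)} (hirr : IrrG G) (hev : 2 ∣ Nat.card V)
    (haff : AffG G) (hsolv : Group.IsSolvable G) (htr : ∀ w : V, Equiv.addRight w ∈ G)
    {α : V} (hα : α ≠ 0) {x : Equiv.Perm V}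
    (hx : Tri G x) (h0 : x 0 = 0) (hD : ∀ g ∈ G, g 0 = 0 → x (g α) = g α) : x = 1 := by
  have hadd : ∀ g ∈ G, g 0 = 0 → ∀ u v, g (u + v) = g u + g v := fun g hg h0 u v => by
    rw [haff g hg, h0, sub_zero]
  let L : Set (V ≃+ V) := {h | h.toEquiv ∈ G}
  have hL : TriP L x := by
    intro a b c
    obtain ⟨g, hg, ea, eb, ec⟩ := hx a b c
    refine ⟨AddEquiv.mk' (Equiv.addRight (-(g 0)) * g) ?_, ?_, ?_, ?_⟩
    · intro u v
      change g (u + v) + -(g 0) = (g u + -(g 0)) + (g v + -(g 0))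
      rw [haff g hg]; abel
    · exact G.mul_mem (htr _) hg
    · change _ = g (b - a) + -(g 0)
      rw [haff.sub hg, ea, eb]; abel
    · change _ = g (c - a) + -(g 0)
      rw [haff.sub hg, ea, ec]; abel
  let HS : Subgroup (Equiv.Perm V) :=
    { carrier := {g | g ∈ G ∧ g 0 = 0}
      one_mem' := ⟨G.one_mem, rfl⟩
      mul_mem' := by
        rintro a b ⟨ha, ha'⟩ ⟨hb, hb'⟩
        exact ⟨G.mul_mem ha hb, by rw [Equiv.Perm.mul_apply, hb', ha']⟩
      inv_mem' := by
        rintro a ⟨ha, ha'⟩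
        exact ⟨G.inv_mem ha, by rw [Equiv.Perm.inv_eq_iff_eq, ha']⟩ }
  have hHS : HS ≤ G := fun g hg => hg.1
  have : Group.IsSolvable HS :=
    Group.isSolvable_of_isSolvable_injective (f := Subgroup.inclusion hHS) (Subgroup.inclusion_injective hHS)
  rcases subsingleton_or_nontrivial HS with hs | hs
  · have hW : AddSubgroup.zmultiples α = ⊤ := by
      refine spanD hirr haff hα _ fun g hg hg0 => ?_
      have : (⟨g, hg, hg0⟩ : HS) = 1 := Subsingleton.elim _ _
      have : g = 1 := congrArg Subtype.val this
      rw [this]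
      exact AddSubgroup.mem_zmultiples α
    have h2 : α + α = 0 := by
      rw [← two_smul (ZMod 2) α]
      have : (2 : ZMod 2) = 0 := by decide
      rw [this, zero_smul]
    have hxα : x α = α := hD 1 G.one_mem rfl
    ext v
    have hv : v ∈ AddSubgroup.zmultiples α := by rw [hW]; trivial
    obtain ⟨n, rfl⟩ := AddSubgroup.mem_zmultiples_iff.1 hv
    have h2' : ∀ k : ℤ, (2 * k) • α = 0 := fun k => by
      rw [mul_comm, mul_smul, two_smul, h2, smul_zero]
    obtain ⟨k, rfl | rfl⟩ := Int.even_or_odd' n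
    · rw [h2', h0]; rfl
    · rw [add_smul, h2', zero_add, one_smul, hxα]; rfl
  · obtain ⟨r, N', hr, hNn, hNe, hNc, hNr⟩ := solv_aux (Γ := HS)
    obtain ⟨N, hNG, hnorm, hcom, hexp, n₀, hn₀, hn₀1⟩ : ∃ N : Subgroup (Equiv.Perm V), N ≤ HS ∧
        (∀ g ∈ HS, ∀ n ∈ N, g * n * g⁻¹ ∈ N) ∧ (∀ a ∈ N, ∀ b ∈ N, a * b = b * a) ∧
        (∀ a ∈ N, a ^ r = 1) ∧ ∃ n ∈ N, n ≠ 1 := by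
      refine ⟨N'.map HS.subtype, ?_, ?_, ?_, ?_, ?_⟩
      · rintro _ ⟨a, -, rfl⟩; exact a.2
      · rintro g hg _ ⟨a, ha, rfl⟩
        exact ⟨_, hNn.conj_mem a ha ⟨g, hg⟩, rfl⟩
      · rintro _ ⟨a, ha, rfl⟩ _ ⟨b, hb, rfl⟩
        exact congrArg Subtype.val (hNc a ha b hb)
      · rintro _ ⟨a, ha, rfl⟩
        exact congrArg Subtype.val (hNr a ha)
      · obtain ⟨a, hne⟩ := Subgroup.ne_bot_iff_exists_ne_one.1 hNe
        exact ⟨a.1.1, ⟨a.1, a.2, rfl⟩, fun e => hne (Subtype.ext (Subtype.ext e))⟩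
    have hNadd : ∀ q ∈ N, ∀ u v, q (u + v) = q u + q v := fun q hq =>
      hadd q (hNG hq).1 (hNG hq).2
    have hfix : ∀ v, (∀ k ∈ N, k v = v) → v = 0 := by
      rcases fixW hirr N hNadd (fun h hh h0 k hk => by
        simpa using hnorm h⁻¹ (HS.inv_mem ⟨hh, h0⟩) k hk) haff with h | h
      · exact h
      · exact absurd (h n₀ hn₀) hn₀1
    have hr2 : r ≠ 2 := by
      rintro rfl
      obtain ⟨v, hv, hf⟩ := pfix Nat.prime_two hev N (fun k hk => (hNG hk).2)
        (fun k => ⟨1, Subtype.ext (by simpa using hexp k.1 k.2)⟩)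
      exact hv (hfix v hf)
    have hodd : Odd (Nat.card N) := by
      have : Fact r.Prime := ⟨hr⟩
      have hN : IsPGroup r N := fun k => ⟨1, Subtype.ext (by simpa using hexp k.1 k.2)⟩
      obtain ⟨k, hk⟩ := IsPGroup.iff_card.1 hN
      rw [hk]
      exact (hr.odd_of_ne_two hr2).pow
    have := core_two N hNadd hcom hr hexp hfix hodd L (fun h hh => G.inv_mem hh)
      (fun h hh q hq => ⟨h.toEquiv * q * (h.toEquiv : Equiv.Perm V)⁻¹,
        hnorm _ ⟨hh, map_zero h⟩ q hq, fun v => by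
          change h (q v) = h (q (h.symm (h v)))
          rw [AddEquiv.symm_apply_apply]⟩) x hL h0
      {v | ∃ g ∈ G, g 0 = 0 ∧ g α = v}
      (by
        rintro _ ⟨g, hg, hg0, rfl⟩ q hq
        exact hD (q * g) (G.mul_mem (hNG hq).1 hg)
          (by rw [Equiv.Perm.mul_apply, hg0]; exact (hNG hq).2))
      (fun W hW => spanD hirr haff hα W fun g hg hg0 => hW ⟨g, hg, hg0, rfl⟩)
    ext v
    exact this v

/-- If the zero-stabilizer `H` of a primitive solvable `G ≤ AGL(d,p)` induces
a 2-closed permutation group on the orbit `Δ = α^H` of some nonzero vector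
`α`, then `G` is 3-closed. -/
theorem stmt12 {p d : ℕ} (hp : p.Prime) (hd : 1 ≤ d)
    (G : Subgroup (Equiv.Perm (Fin d → ZMod p)))
    (hsolv : IsSolvable G) (hprim : IsPrimitiveSubgroup G)
    -- `G ≤ AGL(d, p)`
    (hAGL : ∀ g ∈ G, ∃ (A : (Fin d → ZMod p) ≃ₗ[ZMod p] (Fin d → ZMod p))
        (b : Fin d → ZMod p), ∀ v, g v = A v + b)
    -- the zero-stabilizer `H = G₀` is irreducible
    (hirr : ∀ W : Submodule (ZMod p) (Fin d → ZMod p),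
      (∀ g ∈ G, g 0 = 0 → ∀ w ∈ W, g w ∈ W) → W = ⊥ ∨ W = ⊤)
    (α : Fin d → ZMod p) (hα : α ≠ 0)
    -- the permutation group induced by `H = G₀` on `Δ = α^H` is 2-closed:
    -- any permutation of `Δ` preserving the 2-orbits of `H` on `Δ` is
    -- induced by an element of `H`
    (h2cl : ∀ t : Equiv.Perm {v : Fin d → ZMod p // ∃ g ∈ G, g 0 = 0 ∧ g α = v},
      (∀ x y : {v : Fin d → ZMod p // ∃ g ∈ G, g 0 = 0 ∧ g α = v},
        ∃ g ∈ G, g 0 = 0 ∧ g x.1 = (t x).1 ∧ g y.1 = (t y).1) →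
      ∃ g ∈ G, g 0 = 0 ∧ ∀ x : {v : Fin d → ZMod p // ∃ g ∈ G, g 0 = 0 ∧ g α = v},
        g x.1 = (t x).1) :
    mClosure 3 G = G := by
  have : Fact p.Prime := ⟨hp⟩
  have haff : AffG G := by
    intro g hg u v
    obtain ⟨A, b, h⟩ := hAGL g hg
    rw [h, h, h, h, map_add, map_zero]; abel
  have hirr' : IrrG G := by
    intro W hW
    rcases hirr (AddSubgroup.toZModSubmodule p W) hW with h | h
    · left
      ext v
      have : v ∈ AddSubgroup.toZModSubmodule p W ↔ v ∈ (⊥ : Submodule (ZMod p) (Fin d → ZMod p)) := by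
        rw [h]
      simpa using this
    · right
      ext v
      have : v ∈ AddSubgroup.toZModSubmodule p W ↔ v ∈ (⊤ : Submodule (ZMod p) (Fin d → ZMod p)) := by
        rw [h]
      simpa using this
  have hfin : ∀ x : Equiv.Perm (Fin d → ZMod p), Tri G x → x 0 = 0 →
      (∀ g ∈ G, g 0 = 0 → x (g α) = g α) → x = 1 := by
    intro x hx h0 hD
    by_cases h2 : p = 2
    · subst h2
      have hcard : Nat.card (Fin d → ZMod 2) = 2 ^ d := by simp
      have : Nonempty (Fin d) := ⟨⟨0, hd⟩⟩
      exact main_two hirr' (hcard ▸ dvd_pow_self 2 (by omega)) haff hsolv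
        (transl Nat.prime_two hd hcard hirr' haff hsolv hprim) hα hx h0 hD
    · refine main_odd hirr' haff (fun v => ⟨(2 : ZMod p)⁻¹ • v, ?_⟩) hα hx h0 hD
      have h2' : (2 : ZMod p) ≠ 0 := by
        intro h
        have h : ((2 : ℕ) : ZMod p) = 0 := by exact_mod_cast h
        rw [ZMod.natCast_eq_zero_iff] at h
        exact h2 ((Nat.prime_dvd_prime_iff_eq hp Nat.prime_two).1 h)
      rw [← two_smul (ZMod p), smul_smul, mul_inv_cancel₀ h2', one_smul]
  have htri_mul : ∀ g ∈ G, ∀ x : Equiv.Perm (Fin d → ZMod p), Tri G x → Tri G (g * x) := by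
    intro g hg x hx a b c
    obtain ⟨k, hk, ea, eb, ec⟩ := hx a b c
    exact ⟨g * k, G.mul_mem hg hk, by simp [ea], by simp [eb], by simp [ec]⟩
  have hmem : ∀ x : Equiv.Perm (Fin d → ZMod p), Tri G x → x 0 = 0 → x ∈ G := by
    intro x hx h0
    have hst : ∀ v, (∃ g ∈ G, g 0 = 0 ∧ g α = v) ↔ ∃ g ∈ G, g 0 = 0 ∧ g α = x v := by
      intro v
      obtain ⟨k, hk, e0, ev, -⟩ := hx 0 v v
      rw [h0] at e0
      constructor
      · rintro ⟨g, hg, hg0, rfl⟩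
        exact ⟨k * g, G.mul_mem hk hg, by simp [hg0, e0], by simp [ev]⟩
      · rintro ⟨g, hg, hg0, e⟩
        refine ⟨k⁻¹ * g, G.mul_mem (G.inv_mem hk) hg, ?_, ?_⟩
        · rw [Equiv.Perm.mul_apply, hg0, Equiv.Perm.inv_eq_iff_eq, e0]
        · rw [Equiv.Perm.mul_apply, Equiv.Perm.inv_eq_iff_eq, e, ev]
    obtain ⟨g, hg, hg0, hgx⟩ := h2cl (x.subtypeEquiv hst) (by
      intro u v
      obtain ⟨k, hk, e0, eu, ev⟩ := hx 0 u.1 v.1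
      exact ⟨k, hk, by rw [e0, h0], eu, ev⟩)
    have h1 := hfin (g⁻¹ * x) (htri_mul _ (G.inv_mem hg) x hx)
      (by rw [Equiv.Perm.mul_apply, h0, Equiv.Perm.inv_eq_iff_eq, hg0]) (by
        intro k hk hk0
        rw [Equiv.Perm.mul_apply, Equiv.Perm.inv_eq_iff_eq]
        exact (hgx ⟨k α, k, hk, hk0, rfl⟩).symm)
    rw [inv_mul_eq_one] at h1
    exact h1 ▸ hg
  refine le_antisymm (sSup_le ?_) (le_sSup fun a b => Iff.rfl)
  intro K hK x hxK
  have hx : Tri G x := by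
    intro a b c
    obtain ⟨g, hg, e⟩ := (hK ![a, b, c] ![x a, x b, x c]).2 ⟨x, hxK, fun i => by
      fin_cases i <;> rfl⟩
    exact ⟨g, hg, e 0, e 1, e 2⟩
  obtain ⟨g, hg, e⟩ := hprim.1 (x 0) 0
  have := hmem (g * x) (htri_mul g hg x hx) e
  exact (G.mul_mem_cancel_left hg).1 this
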